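/- In the vertex-coloured game with infinitely many colours, Maker can obtain infinitely many colours infinitely often: let c : ℕ → ℕ be a colouring of the vertices such that every colour class c⁻¹(i) is infinite. Then Maker has a valid strategy such that in every play following it there is an infinite set W ⊆ ℕ with every edge having both endpoints in W among Maker's claimed edges, and such that the set of colours i ∈ ℕ for which W ∩ c⁻¹(i) is infinite is itself infinite. -/

import Mathlib

/-- The board: edges of the complete graph on ℕ, i.e. unordered pairs of
distinct natural numbers. -/
abbrev Edge := {e : Sym2 ℕ // ¬ e.IsDiag}

/-- The interleaved sequence of moves M 0, B 0, M 1, B 1, … . -/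
def interleave (M B : ℕ → Edge) (n : ℕ) : Edge :=
  if n % 2 = 0 then M (n / 2) else B (n / 2)

/-- A play of the game: all the moves M 0, B 0, M 1, B 1, … are pairwise distinct. -/
def IsPlay (M B : ℕ → Edge) : Prop :=
  Function.Injective (interleave M B)

/-- The history M 0, B 0, …, M (n-1), B (n-1) seen by Maker before her n-th move. -/
def histM (M B : ℕ → Edge) : ℕ → List Edge
  | 0 => []
  | n + 1 => histM M B n ++ [M n, B n]

/-- The history M 0, B 0, …, M n seen by Breaker before his n-th move. -/
def histB (M B : ℕ → Edge) (n : ℕ) : List Edge :=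
  histM M B n ++ [M n]

/-- A strategy is valid if it never names an already claimed edge. -/
def ValidStrat (σ : List Edge → Edge) : Prop :=
  ∀ h, σ h ∉ h

/-- The play (M, B) follows the Maker strategy σ. -/
def FollowsMaker (σ : List Edge → Edge) (M B : ℕ → Edge) : Prop :=
  ∀ n, M n = σ (histM M B n)

/-- The play (M, B) follows the Breaker strategy τ. -/
def FollowsBreaker (τ : List Edge → Edge) (M B : ℕ → Edge) : Prop :=
  ∀ n, B n = τ (histB M B n)

/-- Every edge with both endpoints in W is among Maker's claimed edges. -/
def BuildsClique (M : ℕ → Edge) (W : Set ℕ) : Prop :=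
  ∀ u ∈ W, ∀ v ∈ W, u ≠ v → ∃ n, (M n : Sym2 ℕ) = s(u, v)

open Classical in
/-- number of records of colour `j` passing through `P` -/
noncomputable def cntR (c : ℕ → ℕ) (recs : List (ℕ × List ℕ)) (j : ℕ) (P : List ℕ) : ℕ :=
  recs.countP (fun r => decide (c r.1 = j ∧ P <:+ r.2))

def PassC (c : ℕ → ℕ) (recs : List (ℕ × List ℕ)) (x : ℕ) (Q : List ℕ) (a : ℕ) : Prop :=
  ¬ Even (cntR c recs (c x) Q) ∧ (a, Q) ∈ recs ∧ ∃ F : Finset ℕ, F.card ≤ 2 * Q.length ∧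
    ∀ b, (b, Q) ∈ recs → b ∉ F →
      cntR c recs (c x) (a :: Q) + a ≤ cntR c recs (c x) (b :: Q) + b

def StopC (c : ℕ → ℕ) (recs : List (ℕ × List ℕ)) (x : ℕ) (Q : List ℕ) : Prop :=
  Even (cntR c recs (c x) Q) ∨ ∃ F : Finset ℕ, F.card ≤ 2 * Q.length ∧
    ∀ b, (b, Q) ∈ recs → b ∈ F

structure GoodR (c : ℕ → ℕ) (E : Set (Sym2 ℕ)) (rest : List (ℕ × List ℕ)) (r : ℕ × List ℕ) :
    Prop where
  col : c r.1 = (Nat.unpair rest.length).1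
  fresh : ∀ q ∈ rest, q.1 ≠ r.1
  root : [0] <:+ r.2
  edges : ∀ p ∈ r.2, s(r.1, p) ∈ E
  pass : ∀ a Q, (a :: Q) <:+ r.2 → Q ≠ [] → PassC c rest r.1 Q a
  halts : StopC c rest r.1 r.2

/-! Combinatorial part -/

structure Chain (c : ℕ → ℕ) (E : Set (Sym2 ℕ)) (R : ℕ → List (ℕ × List ℕ))
    (r : ℕ → ℕ × List ℕ) : Prop where
  zero : R 0 = []
  succ : ∀ k, R (k+1) = r k :: R k
  good : ∀ k, GoodR c E (R k) (r k)

section comb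
variable {c : ℕ → ℕ} {E : Set (Sym2 ℕ)} {R : ℕ → List (ℕ × List ℕ)} {r : ℕ → ℕ × List ℕ}

def arr (c : ℕ → ℕ) (r : ℕ → ℕ × List ℕ) (j : ℕ) (P : List ℕ) (k : ℕ) : Prop :=
  c (r k).1 = j ∧ P <:+ (r k).2

def InfC (c : ℕ → ℕ) (r : ℕ → ℕ × List ℕ) (P : List ℕ) : Set ℕ :=
  {j | (Set.ofPred (arr c r j P)).Infinite}

theorem Chain.length (h : Chain c E R r) (k : ℕ) : (R k).length = k := by
  induction k with
  | zero => simp [h.zero]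
  | succ k ih => simp [h.succ, ih]

theorem Chain.mem (h : Chain c E R r) (k : ℕ) (q : ℕ × List ℕ) :
    q ∈ R k ↔ ∃ i < k, r i = q := by
  induction k with
  | zero => simp [h.zero]
  | succ k ih =>
    rw [h.succ, List.mem_cons, ih]
    constructor
    · rintro (rfl | ⟨i, hi, rfl⟩)
      · exact ⟨k, by omega, rfl⟩
      · exact ⟨i, by omega, rfl⟩
    · rintro ⟨i, hi, rfl⟩
      rcases Nat.lt_succ_iff_lt_or_eq.1 hi with h1 | rfl
      · exact Or.inr ⟨i, h1, rfl⟩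
      · exact Or.inl rfl

open Classical in
theorem Chain.cnt (h : Chain c E R r) (k j : ℕ) (P : List ℕ) :
    cntR c (R k) j P = Nat.count (arr c r j P) k := by
  induction k with
  | zero => simp [h.zero, cntR]
  | succ k ih =>
    unfold cntR at ih ⊢
    rw [h.succ, List.countP_cons, ih, Nat.count_succ]
    simp only [decide_eq_true_eq]
    by_cases hq : c (r k).1 = j ∧ P <:+ (r k).2
    · rw [if_pos hq, if_pos (show arr c r j P k from hq)]
    · rw [if_neg hq, if_neg (show ¬ arr c r j P k from hq)]

theorem Chain.inj (h : Chain c E R r) : Function.Injective (fun k => (r k).1) := by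
  have key : ∀ i k, i < k → (r i).1 ≠ (r k).1 := fun i k hik =>
    (h.good k).fresh (r i) ((h.mem k _).2 ⟨i, hik, rfl⟩)
  intro i k hik
  rcases lt_trichotomy i k with h1 | h1 | h1
  · exact absurd hik (key _ _ h1)
  · exact h1
  · exact absurd hik.symm (key _ _ h1)

theorem suffix_ne {P L : List ℕ} (h : P <:+ L) (hne : L ≠ P) : ∃ a, (a :: P) <:+ L := by
  obtain ⟨t, rfl⟩ := h
  rcases List.eq_nil_or_concat t with rfl | ⟨t', a, rfl⟩
  · simp at hne
  · exact ⟨a, t', by simp⟩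

theorem Chain.stops (h : Chain c E R r) {P : List ℕ} (hP : P ≠ []) {j : ℕ} (hj : j ∈ InfC c r P) :
    {k | c (r k).1 = j ∧ (r k).2 = P}.Infinite := by
  classical
  have hinf : (Set.ofPred (arr c r j P)).Infinite := hj
  have : ∀ m, c (r (Nat.nth (arr c r j P) (2*m))).1 = j ∧ (r (Nat.nth (arr c r j P) (2*m))).2 = P := by
    intro m
    have hm := Nat.nth_mem_of_infinite hinf (2*m)
    refine ⟨hm.1, ?_⟩
    by_contra hne
    obtain ⟨a, ha⟩ := suffix_ne hm.2 hne
    have := ((h.good _).pass a P ha hP).1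
    rw [hm.1, h.cnt, Nat.count_nth_of_infinite hinf] at this
    exact this (even_two_mul m)
  refine Set.infinite_of_injective_forall_mem (f := fun m => Nat.nth (arr c r j P) (2*m)) ?_ this
  intro m m' hmm
  have := (Nat.nth_strictMono hinf).injective hmm
  omega

theorem Chain.bad (h : Chain c E R r) {P : List ℕ} {j : ℕ} (hj : j ∈ InfC c r P)
    (hP : P ≠ []) (T : Finset ℕ) (hT : ∀ a ∈ T, ∃ k, r k = (a, P)) (hcard : 2 * P.length < T.card) :
    ∃ a ∈ T, j ∈ InfC c r (a :: P) := by
  classical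
  by_contra hcon
  push Not at hcon
  have hinf : (Set.ofPred (arr c r j P)).Infinite := hj
  choose! kk hkk using hT
  -- bounds
  have hb : ∀ a ∈ T, ∃ C, ∀ k, Nat.count (arr c r j (a :: P)) k ≤ C := by
    intro a ha
    have hf : (Set.ofPred (arr c r j (a :: P))).Finite := by
      have := hcon a ha
      simpa [InfC, Set.not_infinite] using this
    refine ⟨hf.toFinset.card, fun k => ?_⟩
    rw [Nat.count_eq_card_filter_range]
    apply Finset.card_le_card
    intro i hi
    simp at hi ⊢
    exact hi.2
  choose! C hC using hb
  set D := T.sup (fun a => C a + a) with hD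
  set K := T.sup kk with hK
  have step : ∀ m, K ≤ m → ∃ a ≤ D, arr c r j (a::P) (Nat.nth (arr c r j P) (2*m+1)) ∧
      Nat.count (arr c r j (a::P)) (Nat.nth (arr c r j P) (2*m+1)) ≤ D := by
    intro m hm
    set k := Nat.nth (arr c r j P) (2*m+1) with hk
    have hmem := Nat.nth_mem_of_infinite hinf (2*m+1)
    rw [← hk] at hmem
    have hkm : 2*m+1 ≤ k := (Nat.nth_strictMono hinf).le_apply
    have hcnt : Nat.count (arr c r j P) k = 2*m+1 := Nat.count_nth_of_infinite hinf _
    have hTm : ∀ a ∈ T, (a, P) ∈ R k := by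
      intro a ha
      refine (h.mem _ _).2 ⟨kk a, ?_, hkk a ha⟩
      have : kk a ≤ K := Finset.le_sup (f := kk) ha
      omega
    have hne : (r k).2 ≠ P := by
      intro he
      rcases (h.good k).halts with h1 | ⟨F, hF, h1⟩
      · rw [he, hmem.1, h.cnt, hcnt] at h1
        exact absurd h1 (by simp)
      · rw [he] at h1 hF
        have : T ⊆ F := fun a ha => h1 a (hTm a ha)
        have := Finset.card_le_card this
        omega
    obtain ⟨a, ha⟩ := suffix_ne hmem.2 hne
    obtain ⟨-, -, F, hF, hmin⟩ := (h.good k).pass a P ha hP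
    obtain ⟨b, hbT, hbF⟩ : ∃ b ∈ T, b ∉ F := by
      by_contra hc
      push Not at hc
      have := Finset.card_le_card (show T ⊆ F from hc)
      omega
    have h2 := hmin b (hTm b hbT) hbF
    rw [hmem.1, h.cnt, h.cnt] at h2
    have h3 := hC b hbT k
    have h4 : C b + b ≤ D := Finset.le_sup (f := fun a => C a + a) hbT
    exact ⟨a, by omega, ⟨hmem.1, ha⟩, by omega⟩
  choose! f hf1 hf2 hf3 using step
  have hinf2 : (Set.Ici K).Infinite := Set.Ici_infinite K
  have : ∃ a ≤ D, {m | K ≤ m ∧ f m = a}.Infinite := by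
    by_contra hc
    push Not at hc
    apply hinf2
    refine Set.Finite.subset ((Set.finite_Iic D).biUnion (t := fun a => {m | K ≤ m ∧ f m = a})
      (fun a ha => by simpa using hc a ha)) ?_
    intro m hm
    simp only [Set.mem_iUnion]
    exact ⟨f m, hf1 m hm, hm, rfl⟩
  obtain ⟨a, -, ha⟩ := this
  have hinj : Function.Injective (fun m => Nat.nth (arr c r j P) (2*m+1)) := by
    intro m m' hmm
    have := (Nat.nth_strictMono hinf).injective hmm
    omega
  have hK' := ha.image (f := fun m => Nat.nth (arr c r j P) (2*m+1)) hinj.injOn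
  have hia : (Set.ofPred (arr c r j (a::P))).Infinite := by
    refine hK'.mono ?_
    rintro _ ⟨m, ⟨hm, rfl⟩, rfl⟩
    exact hf2 m hm
  obtain ⟨_, ⟨m, ⟨hm, rfl⟩, rfl⟩, hgt⟩ := hK'.exists_gt (Nat.nth (arr c r j (a :: P)) (D+1))
  have h5 := Nat.count_monotone (arr c r j (f m :: P)) hgt.le
  rw [Nat.count_nth_of_infinite hia] at h5
  have := hf3 m hm
  simp only at h5
  omega

theorem Chain.step (h : Chain c E R r) {P : List ℕ} (hP : P ≠ []) (hinf : (InfC c r P).Infinite)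
    (S : Finset ℕ) (hS : ↑S ⊆ InfC c r P) {e : ℕ} (he : e ∈ InfC c r P) :
    ∃ a, c a = e ∧ (∃ k, r k = (a, P)) ∧ (InfC c r (a :: P)).Infinite ∧ ↑S ⊆ InfC c r (a :: P) := by
  classical
  set A : Set ℕ := {a | c a = e ∧ ∃ k, r k = (a, P)} with hA
  have hAinf : A.Infinite := by
    have h1 := (h.stops hP he).image (f := fun k => (r k).1) (h.inj.injOn)
    refine h1.mono ?_
    rintro _ ⟨k, ⟨hk1, hk2⟩, rfl⟩
    exact ⟨hk1, k, by rw [← hk2]⟩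
  set Bd : ℕ → Set ℕ := fun j => {a | (∃ k, r k = (a, P)) ∧ j ∉ InfC c r (a :: P)} with hBd
  have hB : ∀ j ∈ InfC c r P, (Bd j).Finite := by
    intro j hj
    by_contra hi
    obtain ⟨T, hT, hTc⟩ := Set.Infinite.exists_subset_card_eq hi (2 * P.length + 1)
    obtain ⟨a, ha, ha'⟩ := h.bad hj hP T (fun a ha => (hT ha).1) (by omega)
    exact (hT ha).2 ha'
  have hU : (⋃ j ∈ S, Bd j).Finite := S.finite_toSet.biUnion (fun j hj => hB j (hS hj))
  obtain ⟨T, hT, hTc⟩ := Set.Infinite.exists_subset_card_eq (hAinf.sdiff hU) (2 * P.length + 1)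
  have : ∃ a ∈ T, (InfC c r (a::P)).Infinite := by
    by_contra hc
    push Not at hc
    apply hinf
    refine Set.Finite.subset (T.finite_toSet.biUnion (t := fun a => InfC c r (a::P)) 
      (fun a ha => by simpa using hc a ha)) ?_
    intro j hj
    obtain ⟨a, ha, ha'⟩ := h.bad hj hP T (fun a ha => (hT ha).1.2) (by omega)
    simp only [Set.mem_iUnion]
    exact ⟨a, ha, ha'⟩
  obtain ⟨a, ha, hai⟩ := this
  refine ⟨a, (hT ha).1.1, (hT ha).1.2, hai, ?_⟩
  intro j hj
  by_contra hc
  apply (hT ha).2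
  simp only [Set.mem_iUnion]
  exact ⟨j, hj, (hT ha).1.2, hc⟩

/-- a good partial branch -/
def Br (c : ℕ → ℕ) (E : Set (Sym2 ℕ)) (r : ℕ → ℕ × List ℕ) (P : List ℕ) (S : Finset ℕ) : Prop :=
  P ≠ [] ∧ (InfC c r P).Infinite ∧ ↑S ⊆ InfC c r P ∧ P.Pairwise (fun a b => s(a,b) ∈ E)

theorem Chain.macro_step (h : Chain c E R r) {P : List ℕ} {S : Finset ℕ} (hb : Br c E r P S)
    (l : List ℕ) (hl : ∀ j ∈ l, j ∈ S) :
    ∃ Q, Br c E r (Q ++ P) S ∧ ∀ j ∈ l, ∃ a ∈ Q, c a = j := by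
  induction l with
  | nil => exact ⟨[], by simpa using hb, by simp⟩
  | cons j l ih =>
    obtain ⟨Q, ⟨h1, h2, h3, h4⟩, hQ⟩ := ih (fun i hi => hl i (List.mem_cons_of_mem _ hi))
    obtain ⟨a, ha, ⟨k, hk⟩, hi, hS⟩ := h.step h1 h2 S h3 (h3 (hl j List.mem_cons_self))
    refine ⟨a :: Q, ⟨by simp, hi, hS, ?_⟩, ?_⟩
    · rw [List.cons_append, List.pairwise_cons]
      refine ⟨?_, h4⟩
      have := (h.good k).edges
      rw [hk] at this
      exact this
    · intro i hi
      rcases List.mem_cons.1 hi with rfl | hi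
      · exact ⟨a, by simp, ha⟩
      · obtain ⟨b, hb, hb'⟩ := hQ i hi
        exact ⟨b, by simp [hb], hb'⟩

theorem Chain.macro_step' (h : Chain c E R r) {P : List ℕ} {S : Finset ℕ} (hb : Br c E r P S) :
    ∃ Q i, i ∉ S ∧ Br c E r (Q ++ P) (insert i S) ∧ ∀ j ∈ S, ∃ a ∈ Q, c a = j := by
  classical
  obtain ⟨h1, h2, h3, h4⟩ := hb
  obtain ⟨i, hi, hiS⟩ := h2.exists_notMem_finset S
  have hb' : Br c E r P (insert i S) := by
    refine ⟨h1, h2, ?_, h4⟩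
    intro j hj
    rcases Finset.mem_insert.1 (Finset.mem_coe.1 hj) with rfl | hj
    · exact hi
    · exact h3 hj
  obtain ⟨Q, hQ, hQ'⟩ := h.macro_step hb' (insert i S).toList (by simp)
  exact ⟨Q, i, hiS, hQ, fun j hj => hQ' j (by simp [hj])⟩

theorem Chain.main (h : Chain c E R r) (hE : ∀ e ∈ E, ¬ e.IsDiag) :
    ∃ W : Set ℕ, W.Infinite ∧ (∀ u ∈ W, ∀ v ∈ W, u ≠ v → s(u,v) ∈ E) ∧
      {i : ℕ | (W ∩ c ⁻¹' {i}).Infinite}.Infinite := by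
  classical
  have h0 : ∀ j, j ∈ InfC c r [0] := by
    intro j
    refine Set.infinite_of_injective_forall_mem (f := fun m => Nat.pair j m) ?_ ?_
    · intro m m' hm
      simpa using hm
    · intro m
      refine ⟨?_, (h.good _).root⟩
      rw [(h.good _).col, h.length]
      simp
  have hbr0 : Br c E r [0] ∅ := by
    refine ⟨by simp, ?_, by simp, by simp⟩
    have : InfC c r [0] = Set.univ := Set.eq_univ_of_forall h0
    rw [this]; exact Set.infinite_univ
  let X := {p : List ℕ × Finset ℕ // Br c E r p.1 p.2}
  have hstep : ∀ x : X, ∃ y : X, ∃ Q i, y.1.1 = Q ++ x.1.1 ∧ i ∉ x.1.2 ∧ y.1.2 = insert i x.1.2 ∧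
      ∀ j ∈ x.1.2, ∃ a ∈ Q, c a = j := by
    rintro ⟨⟨P, S⟩, hx⟩
    obtain ⟨Q, i, h1, h2, h3⟩ := h.macro_step' hx
    exact ⟨⟨⟨Q ++ P, insert i S⟩, h2⟩, Q, i, rfl, h1, rfl, h3⟩
  choose nx hnx using hstep
  let Z : ℕ → X := fun n => Nat.rec ⟨⟨[0], ∅⟩, hbr0⟩ (fun _ x => nx x) n
  have hZ : ∀ n, Z (n+1) = nx (Z n) := fun n => rfl
  set P : ℕ → List ℕ := fun n => (Z n).1.1 with hPdef
  set S : ℕ → Finset ℕ := fun n => (Z n).1.2 with hSdef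
  have hS1 : ∀ n, (S n).card = n := by
    intro n
    induction n with
    | zero => rfl
    | succ n ih =>
      obtain ⟨Q, i, h1, h2, h3, h4⟩ := hnx (Z n)
      rw [← hZ] at h3
      change S (n+1) = insert i (S n) at h3
      rw [h3, Finset.card_insert_of_notMem h2, ih]
  have hSm : Monotone S := by
    apply monotone_nat_of_le_succ
    intro n
    obtain ⟨Q, i, h1, h2, h3, h4⟩ := hnx (Z n)
    rw [← hZ] at h3
    change S (n+1) = insert i (S n) at h3
    rw [h3]; exact Finset.subset_insert _ _
  have hPs : ∀ n, P n <:+ P (n+1) := by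
    intro n
    obtain ⟨Q, i, h1, h2, h3, h4⟩ := hnx (Z n)
    exact ⟨Q, h1.symm⟩
  have hPm : ∀ n m, n ≤ m → P n <:+ P m := by
    intro n m hnm
    induction hnm with
    | refl => exact List.suffix_refl _
    | step _ ih => exact ih.trans (hPs _)
  have hpair : ∀ n, (P n).Pairwise (fun a b => s(a,b) ∈ E) := fun n => (Z n).2.2.2.2
  have hnodup : ∀ n, (P n).Nodup := by
    intro n
    refine (hpair n).imp ?_
    rintro a b hab rfl
    exact hE _ hab (by simp)
  set W : Set ℕ := {a | ∃ n, a ∈ P n} with hW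
  have hcol : ∀ n, ∀ j ∈ S n, (W ∩ c ⁻¹' {j}).Infinite := by
    intro n j hj hfin
    have hc : ∀ m, m ≤ (P (n+m)).countP (fun a => decide (c a = j)) := by
      intro m
      induction m with
      | zero => simp
      | succ m ih =>
        obtain ⟨Q, i, h1, h2, h3, h4⟩ := hnx (Z (n+m))
        rw [← hZ] at h1
        change P (n+(m+1)) = Q ++ P (n+m) at h1
        obtain ⟨a, ha, ha'⟩ := h4 j (hSm (Nat.le_add_right n m) hj)
        rw [h1, List.countP_append]
        have : 0 < Q.countP (fun a => decide (c a = j)) :=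
          List.countP_pos_iff.2 ⟨a, ha, by simpa using ha'⟩
        omega
    have h1 := hc (hfin.toFinset.card + 1)
    rw [List.countP_eq_length_filter] at h1
    set l := (P (n + (hfin.toFinset.card + 1))).filter (fun a => decide (c a = j)) with hl
    have hln : l.Nodup := List.Nodup.filter _ (hnodup (n + (hfin.toFinset.card + 1)))
    have h2 : l.toFinset ⊆ hfin.toFinset := by
      intro a ha
      rw [List.mem_toFinset, hl, List.mem_filter] at ha
      simp only [Set.Finite.mem_toFinset]
      exact ⟨⟨n + (hfin.toFinset.card + 1), ha.1⟩, by simpa using ha.2⟩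
    have h3 := Finset.card_le_card h2
    rw [List.toFinset_card_of_nodup hln] at h3
    omega
  clear_value P S
  refine ⟨W, ?_, ?_, ?_⟩
  · have : (S 1).Nonempty := by rw [← Finset.card_pos, hS1]; exact one_pos
    obtain ⟨j, hj⟩ := this
    exact (hcol 1 j hj).mono Set.inter_subset_left
  · rintro u ⟨n, hu⟩ v ⟨m, hv⟩ huv
    have hu' := (hPm n (max n m) (le_max_left _ _)).subset hu
    have hv' := (hPm m (max n m) (le_max_right _ _)).subset hv
    have : Std.Symm (fun a b : ℕ => s(a,b) ∈ E) := ⟨fun a b hab => by rwa [Sym2.eq_swap]⟩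
    exact (hpair (max n m)).forall hu' hv' huv
  · intro hfin
    have : S (hfin.toFinset.card + 1) ⊆ hfin.toFinset := by
      intro j hj
      simp only [Set.Finite.mem_toFinset]
      exact hcol _ j hj
    have := Finset.card_le_card this
    rw [hS1] at this
    omega

end comb

/-! Game part -/

structure GSt where
  recs : List (ℕ × List ℕ)
  x : ℕ
  P : List ℕ

noncomputable def freshV (c : ℕ → ℕ) (H : List Edge) (recs : List (ℕ × List ℕ)) : ℕ :=
  Classical.epsilon (fun x => c x = (Nat.unpair recs.length).1 ∧ x ≠ 0 ∧
    (∀ e ∈ H, x ∉ (e : Sym2 ℕ)) ∧ ∀ r ∈ recs, r.1 ≠ x)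

theorem freshV_spec {c : ℕ → ℕ} (hc : ∀ i : ℕ, (c ⁻¹' {i}).Infinite) (H : List Edge)
    (recs : List (ℕ × List ℕ)) :
    c (freshV c H recs) = (Nat.unpair recs.length).1 ∧ freshV c H recs ≠ 0 ∧
    (∀ e ∈ H, freshV c H recs ∉ (e : Sym2 ℕ)) ∧ ∀ r ∈ recs, r.1 ≠ freshV c H recs := by
  classical
  apply Classical.epsilon_spec (p := fun x => c x = (Nat.unpair recs.length).1 ∧ x ≠ 0 ∧
    (∀ e ∈ H, x ∉ (e : Sym2 ℕ)) ∧ ∀ r ∈ recs, r.1 ≠ x)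
  have hf : ({0} ∪ (⋃ e ∈ {e | e ∈ H}, {x | x ∈ (e : Sym2 ℕ)}) ∪
      (Prod.fst '' {r | r ∈ recs}) : Set ℕ).Finite := by
    refine ((Set.finite_singleton 0).union ?_).union ?_
    · refine (List.finite_toSet H).biUnion ?_
      rintro ⟨e, he⟩ -
      induction e with
      | _ a b =>
        refine Set.Finite.subset (Set.toFinite {a, b}) ?_
        intro x hx
        simpa using hx
    · exact (List.finite_toSet recs).image _
  obtain ⟨x, hx, hx'⟩ := ((hc (Nat.unpair recs.length).1).sdiff hf).nonempty
  simp only [Set.mem_union, not_or] at hx'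
  refine ⟨x, hx, hx'.1.1, ?_, ?_⟩
  · intro e he hxe
    apply hx'.1.2
    simp only [Set.mem_iUnion]
    exact ⟨e, he, hxe⟩
  · rintro q hq rfl
    exact hx'.2 ⟨q, hq, rfl⟩

def cand (H : List Edge) (s : GSt) (a : ℕ) : Prop :=
  (a, s.P) ∈ s.recs ∧ ∀ e ∈ H, (e : Sym2 ℕ) ≠ s(s.x, a)

noncomputable def val (c : ℕ → ℕ) (s : GSt) (a : ℕ) : ℕ :=
  cntR c s.recs (c s.x) (a :: s.P) + a

noncomputable def best (c : ℕ → ℕ) (H : List Edge) (s : GSt) : ℕ :=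
  Classical.epsilon (fun a => cand H s a ∧ ∀ b, cand H s b → val c s a ≤ val c s b)

theorem best_spec {c : ℕ → ℕ} {H : List Edge} {s : GSt} (h : ∃ a, cand H s a) :
    cand H s (best c H s) ∧ ∀ b, cand H s b → val c s (best c H s) ≤ val c s b := by
  apply Classical.epsilon_spec (p := fun a => cand H s a ∧ ∀ b, cand H s b → val c s a ≤ val c s b)
  obtain ⟨a, ha, hm⟩ := (measure (val c s)).wf.has_min {a | cand H s a} h
  exact ⟨a, ha, fun b hb => not_lt.1 (hm b hb)⟩

open Classical in
noncomputable def nextS (c : ℕ → ℕ) (H : List Edge) (s : GSt) : GSt :=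
  if ¬ Even (cntR c s.recs (c s.x) s.P) ∧ ∃ a, cand H s a then
    ⟨s.recs, s.x, best c H s :: s.P⟩
  else ⟨(s.x, s.P) :: s.recs, freshV c H ((s.x, s.P) :: s.recs), [0]⟩

open Classical in
noncomputable def deg (H : List Edge) (x : ℕ) : ℕ :=
  H.countP (fun e : Edge => decide (x ∈ (e : Sym2 ℕ)))

theorem deg_cover (H : List Edge) (x : ℕ) :
    ∃ F : Finset ℕ, F.card ≤ deg H x ∧ ∀ a, (∃ e ∈ H, (e : Sym2 ℕ) = s(x, a)) → a ∈ F := by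
  classical
  refine ⟨((H.filter (fun e : Edge => decide (x ∈ (e : Sym2 ℕ)))).map
    (fun e : Edge => if h : x ∈ (e : Sym2 ℕ) then Sym2.Mem.other h else 0)).toFinset, ?_, ?_⟩
  · refine (List.toFinset_card_le _).trans ?_
    rw [List.length_map, deg, List.countP_eq_length_filter]
  · rintro a ⟨e, he, hea⟩
    rw [List.mem_toFinset, List.mem_map]
    have hx : x ∈ (e : Sym2 ℕ) := by rw [hea]; simp
    refine ⟨e, by simp [he, hx], ?_⟩
    rw [dif_pos hx]
    have := Sym2.other_spec hx
    exact Sym2.congr_right.1 (this.trans hea)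

structure GInv (c : ℕ → ℕ) (E : Set (Sym2 ℕ)) (H : List Edge) (s : GSt) : Prop where
  recs : ∀ r rest, (r :: rest) <:+ s.recs → GoodR c E rest r
  col : c s.x = (Nat.unpair s.recs.length).1
  fresh : ∀ r ∈ s.recs, r.1 ≠ s.x
  root : [0] <:+ s.P
  edges : ∀ p ∈ s.P.tail, s(s.x, p) ∈ E
  pass : ∀ a Q, (a :: Q) <:+ s.P → Q ≠ [] → PassC c s.recs s.x Q a
  deg : deg H s.x + 2 ≤ 2 * s.P.length
  head : s.x ≠ s.P.headI ∧ ∀ e ∈ H, (e : Sym2 ℕ) ≠ s(s.x, s.P.headI)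
  len : s.P.length ≤ s.recs.length + 1
  lens : ∀ r ∈ s.recs, r.2.length ≤ s.recs.length

theorem ginv_fresh {c : ℕ → ℕ} (hc : ∀ i : ℕ, (c ⁻¹' {i}).Infinite) {E : Set (Sym2 ℕ)}
    (H : List Edge) (recs : List (ℕ × List ℕ))
    (h1 : ∀ r rest, (r :: rest) <:+ recs → GoodR c E rest r)
    (h2 : ∀ r ∈ recs, r.2.length ≤ recs.length) :
    GInv c E H ⟨recs, freshV c H recs, [0]⟩ := by
  classical
  obtain ⟨f1, f2, f3, f4⟩ := freshV_spec hc H recs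
  refine ⟨h1, f1, f4, List.suffix_refl _, by simp, ?_, ?_, ?_, by simp, h2⟩
  · intro a Q h hQ
    have := h.length_le
    simp at this
    exact absurd this hQ
  · have : deg H (freshV c H recs) = 0 := by
      rw [deg, List.countP_eq_zero]
      intro e he
      simpa using f3 e he
    simp [this]
  · refine ⟨f2, fun e he heq => f3 e he ?_⟩
    rw [heq]; simp

theorem ginv_step {c : ℕ → ℕ} (hc : ∀ i : ℕ, (c ⁻¹' {i}).Infinite) {E : Set (Sym2 ℕ)}
    {H H' : List Edge} {s : GSt} (h : GInv c E H s) (hE : s(s.x, s.P.headI) ∈ E)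
    (hH : deg H' s.x ≤ deg H s.x + 2) : GInv c E H' (nextS c H' s) := by
  classical
  have hPne : s.P ≠ [] := by
    intro h0
    have := h.root
    simp [h0] at this
  have hed : ∀ p ∈ s.P, s(s.x, p) ∈ E := by
    intro p hp
    rcases hP : s.P with _ | ⟨t, P'⟩
    · exact absurd hP hPne
    · rw [hP] at hp hE
      rcases List.mem_cons.1 hp with rfl | hp
      · exact hE
      · exact h.edges p (by rw [hP]; exact hp)
  have hdeg : deg H' s.x ≤ 2 * s.P.length := by have := h.deg; omega
  obtain ⟨F, hF, hFm⟩ := deg_cover H' s.x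
  have hcF : ∀ b, (b, s.P) ∈ s.recs → b ∉ F → cand H' s b := by
    intro b hb hbF
    refine ⟨hb, fun e he heq => hbF (hFm b ⟨e, he, heq⟩)⟩
  unfold nextS
  split_ifs with hif
  · obtain ⟨hodd, hex⟩ := hif
    obtain ⟨⟨hb1, hb2⟩, hb3⟩ := best_spec (c := c) hex
    refine ⟨h.recs, h.col, h.fresh, h.root.trans (List.suffix_cons _ _), hed, ?_, ?_, ?_, ?_, h.lens⟩
    · intro a Q hs hQ
      rcases List.suffix_cons_iff.1 hs with heq | hs
      · obtain ⟨rfl, rfl⟩ := List.cons.inj heq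
        exact ⟨hodd, hb1, F, by omega, fun b hb hbF => hb3 b (hcF b hb hbF)⟩
      · exact h.pass a Q hs hQ
    · simp only [List.length_cons]; omega
    · exact ⟨fun heq => h.fresh _ hb1 heq.symm, hb2⟩
    · have := h.lens _ hb1
      simp only [List.length_cons] at this ⊢
      omega
  · apply ginv_fresh hc
    · intro r rest hs
      rcases List.suffix_cons_iff.1 hs with heq | hs
      · obtain ⟨rfl, rfl⟩ := List.cons.inj heq
        refine ⟨h.col, h.fresh, h.root, hed, h.pass, ?_⟩
        rcases not_and_or.1 hif with h1 | h1
        · exact Or.inl (not_not.1 h1)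
        · refine Or.inr ⟨F, by simp only; omega, fun b hb => ?_⟩
          by_contra hbF
          exact h1 ⟨b, hcF b hb hbF⟩
      · exact h.recs r rest hs
    · intro r hr
      rcases List.mem_cons.1 hr with rfl | hr
      · exact h.len
      · have := h.lens r hr
        simp only [List.length_cons]; omega

noncomputable def stOf (c : ℕ → ℕ) (h : List Edge) : GSt :=
  if h.length < 2 then ⟨[], freshV c [] [], [0]⟩ else nextS c h (stOf c h.dropLast.dropLast)
termination_by h.length
decreasing_by simp; omega

theorem stOf_nil (c : ℕ → ℕ) : stOf c [] = ⟨[], freshV c [] [], [0]⟩ := by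
  rw [stOf]; simp

theorem stOf_app (c : ℕ → ℕ) (h : List Edge) (a b : Edge) :
    stOf c (h ++ [a, b]) = nextS c (h ++ [a, b]) (stOf c h) := by
  have e : (h ++ [a, b]).dropLast.dropLast = h := by
    have : h ++ [a, b] = (h ++ [a]) ++ [b] := by simp
    rw [this, List.dropLast_concat, List.dropLast_concat]
  rw [stOf, if_neg (by simp), e]

theorem exists_new (h : List Edge) : ∃ e : Edge, e ∉ h := by
  have : Infinite Edge := by
    refine Infinite.of_injective (fun n : ℕ => (⟨s(0, n+1), by simp⟩ : Edge)) ?_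
    intro a b hab
    simpa using hab
  obtain ⟨e, he⟩ := (List.finite_toSet h).infinite_compl.nonempty
  exact ⟨e, he⟩

open Classical in
noncomputable def strat (c : ℕ → ℕ) (h : List Edge) : Edge :=
  if hh : ∃ e : Edge, e ∉ h ∧ (e : Sym2 ℕ) = s((stOf c h).x, (stOf c h).P.headI) then hh.choose
  else (exists_new h).choose

theorem strat_valid (c : ℕ → ℕ) : ValidStrat (strat c) := by
  intro h
  unfold strat
  split_ifs with hh
  · exact hh.choose_spec.1
  · exact (exists_new h).choose_spec

theorem strat_eq {c : ℕ → ℕ} {E : Set (Sym2 ℕ)} {h : List Edge} (hi : GInv c E h (stOf c h)) :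
    (strat c h : Sym2 ℕ) = s((stOf c h).x, (stOf c h).P.headI) := by
  have hh : ∃ e : Edge, e ∉ h ∧ (e : Sym2 ℕ) = s((stOf c h).x, (stOf c h).P.headI) :=
    ⟨⟨_, by simpa using hi.head.1⟩, fun hm => hi.head.2 _ hm rfl, rfl⟩
  unfold strat
  rw [dif_pos hh]
  exact hh.choose_spec.2

theorem ginv_all {c : ℕ → ℕ} (hc : ∀ i : ℕ, (c ⁻¹' {i}).Infinite) {M B : ℕ → Edge}
    (hf : FollowsMaker (strat c) M B) (n : ℕ) :
    GInv c (Set.range fun n => (M n : Sym2 ℕ)) (histM M B n) (stOf c (histM M B n)) := by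
  induction n with
  | zero =>
    simp only [histM]
    rw [stOf_nil]
    apply ginv_fresh hc <;> simp
  | succ n ih =>
    simp only [histM]
    rw [stOf_app]
    refine ginv_step hc ih ⟨n, ?_⟩ ?_
    · simp only
      rw [hf n]; exact strat_eq ih
    · unfold deg
      rw [List.countP_append]
      exact Nat.add_le_add_left List.countP_le_length _

theorem chain_of_states {c : ℕ → ℕ} {E : Set (Sym2 ℕ)} (Z : ℕ → GSt)
    (hr : ∀ n r rest, (r :: rest) <:+ (Z n).recs → GoodR c E rest r)
    (h0 : (Z 0).recs = [])
    (hlen : ∀ n, (Z n).P.length ≤ (Z n).recs.length + 1)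
    (hs : ∀ n, ((Z (n+1)).recs = (Z n).recs ∧ (Z (n+1)).P.length = (Z n).P.length + 1) ∨
      ∃ r, (Z (n+1)).recs = r :: (Z n).recs) :
    ∃ R r, Chain c E R r := by
  have hsuf : ∀ n, (Z n).recs <:+ (Z (n+1)).recs := by
    intro n
    rcases hs n with h | ⟨r, h⟩
    · rw [h.1]
    · rw [h]; exact List.suffix_cons _ _
  have hsufm : ∀ n m, n ≤ m → (Z n).recs <:+ (Z m).recs := by
    intro n m hnm
    induction hnm with
    | refl => exact List.suffix_refl _
    | step _ ih => exact ih.trans (hsuf _)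
  have hgrow : ∀ n, ∃ m, ∃ r, (Z (n+m+1)).recs = r :: (Z n).recs := by
    intro n
    by_contra hcon
    push Not at hcon
    have : ∀ m, (Z (n+m)).recs = (Z n).recs ∧ (Z (n+m)).P.length = (Z n).P.length + m := by
      intro m
      induction m with
      | zero => simp
      | succ m ih =>
        rcases hs (n+m) with h | ⟨r, h⟩
        · refine ⟨h.1.trans ih.1, ?_⟩
          have := h.2
          rw [← add_assoc, this, ih.2]; omega
        · rw [ih.1] at h
          exact absurd h (hcon m r)
    have h1 := this ((Z n).recs.length + 2)
    have h2 := hlen (n + ((Z n).recs.length + 2))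
    rw [h1.1, h1.2] at h2
    omega
  have hk : ∀ k, ∃ n, (Z n).recs.length = k := by
    intro k
    induction k with
    | zero => exact ⟨0, by simp [h0]⟩
    | succ k ih =>
      obtain ⟨n, hn⟩ := ih
      obtain ⟨m, r, h⟩ := hgrow n
      exact ⟨_, by rw [h, List.length_cons, hn]⟩
  choose t ht using hk
  have huniq : ∀ n m, (Z n).recs.length = (Z m).recs.length → (Z n).recs = (Z m).recs := by
    intro n m h
    rcases le_total n m with h' | h'
    · exact (hsufm n m h').eq_of_length h
    · exact ((hsufm m n h').eq_of_length h.symm).symm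
  have hsucc : ∀ k, ∃ r, (Z (t (k+1))).recs = r :: (Z (t k)).recs := by
    intro k
    obtain ⟨m, r, h⟩ := hgrow (t k)
    refine ⟨r, ?_⟩
    rw [← h]
    apply huniq
    rw [h, ht, List.length_cons, ht]
  choose r hrr using hsucc
  refine ⟨fun k => (Z (t k)).recs, r, ?_, hrr, ?_⟩
  · exact List.length_eq_zero_iff.1 (ht 0)
  · intro k
    apply hr (t (k+1))
    rw [hrr]

/-- In the vertex-coloured game with infinitely many colours (every colour class
infinite), Maker can build a K^{ℵ₀} in which infinitely many colours each
appear infinitely often. -/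
theorem maker_wins_infinitely_many_colours (c : ℕ → ℕ)
    (hc : ∀ i : ℕ, (c ⁻¹' {i}).Infinite) :
    ∃ σ : List Edge → Edge, ValidStrat σ ∧
      ∀ M B : ℕ → Edge, IsPlay M B → FollowsMaker σ M B →
        ∃ W : Set ℕ, W.Infinite ∧ BuildsClique M W ∧
          {i : ℕ | (W ∩ c ⁻¹' {i}).Infinite}.Infinite := by
  refine ⟨strat c, strat_valid c, fun M B _ hf => ?_⟩
  have hinv := ginv_all hc hf
  obtain ⟨R, r, hR⟩ := chain_of_states (fun n => stOf c (histM M B n))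
    (fun n => (hinv n).recs) (by simp [histM, stOf_nil]) (fun n => (hinv n).len) (by
      intro n
      simp only [histM]
      rw [stOf_app]
      unfold nextS
      split_ifs with h
      · exact Or.inl ⟨rfl, rfl⟩
      · exact Or.inr ⟨_, rfl⟩)
  obtain ⟨W, h1, h2, h3⟩ := hR.main (by rintro _ ⟨n, rfl⟩; exact (M n).2)
  exact ⟨W, h1, h2, h3⟩
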